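/- arXiv:math/0612814 — 11 statements merged into one kernel-verified Lean document; each statement's English description precedes it below -/
import Mathlib

section
/- Let X be a set and R : X × X → X × X a reversible Yang–Baxter map. Then for every n ≥ 2 the transfer maps T_i^{(n)} : X^n → X^n, i = 1, …, n, pairwise commute: T_i^{(n)} ∘ T_j^{(n)} = T_j^{(n)} ∘ T_i^{(n)} for all i, j ∈ {1, …, n}. -/
/-- The map `R_{ij} : Xⁿ → Xⁿ` acting as `R` on the `i`-th and `j`-th coordinates:
it replaces the `i`-th coordinate `x i` by `f (x i, x j)` and the `j`-th coordinate `x j`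
by `g (x i, x j)`, where `R (x, y) = (f (x, y), g (x, y))`, leaving the others fixed. -/
def Rij {X : Type*} (R : X × X → X × X) {n : ℕ} (i j : Fin n) (x : Fin n → X) : Fin n → X :=
  fun k => if k = i then (R (x i, x j)).1 else if k = j then (R (x i, x j)).2 else x k

/-- The transfer map `T_i^{(n)} = R_{i,i+n-1} ∘ R_{i,i+n-2} ∘ ⋯ ∘ R_{i,i+1}`,
with indices taken modulo `n`; the rightmost map `R_{i,i+1}` is applied first. -/
def transfer {X : Type*} (R : X × X → X × X) {n : ℕ} (i : Fin n) :
    (Fin n → X) → (Fin n → X) :=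
  fun x => (List.range (n - 1)).foldl
    (fun y k => Rij R i (i + ⟨(k + 1) % n, Nat.mod_lt _ i.pos⟩) y) x

section Exchange

variable {M ι : Type*} [Monoid M]

/-- The product `r i lₘ * ⋯ * r i l₁` over a list `[l₁, …, lₘ]`. -/
def sweep (r : ι → ι → M) (i : ι) : List ι → M
  | [] => 1
  | k :: L => sweep r i L * r i k

theorem sweep_append (r : ι → ι → M) (i : ι) (A B : List ι) :
    sweep r i (A ++ B) = sweep r i B * sweep r i A := by
  induction A with
  | nil => simp [sweep]
  | cons k A ih => simp [sweep, ih, mul_assoc]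

theorem commute_sweep_right {r : ι → ι → M} {i : ι} {a : M} {L : List ι}
    (h : ∀ k ∈ L, Commute a (r i k)) : Commute a (sweep r i L) := by
  induction L with
  | nil => exact Commute.one_right a
  | cons k L ih =>
    exact (ih fun l hl => h l (List.mem_cons_of_mem k hl)).mul_right (h k List.mem_cons_self)

theorem commute_sweep_sweep {r : ι → ι → M} {i j : ι} {A B : List ι}
    (h : ∀ a ∈ A, ∀ b ∈ B, Commute (r i a) (r j b)) :
    Commute (sweep r i A) (sweep r j B) :=
  commute_sweep_right fun b hb => (commute_sweep_right fun a ha => (h a ha b hb).symm).symm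

/-- `r i j` exchanges the sweeps of `i` and `j` along a common list. -/
theorem mul_sweep_mul_sweep {r : ι → ι → M}
    (hcomm : ∀ i j k l, i ≠ k → i ≠ l → j ≠ k → j ≠ l → Commute (r i j) (r k l))
    (hyb : ∀ i j k, i ≠ j → i ≠ k → j ≠ k → r i j * r i k * r j k = r j k * r i k * r i j)
    {i j : ι} (hij : i ≠ j) {L : List ι} (hL : L.Nodup) (hi : i ∉ L) (hj : j ∉ L) :
    r i j * sweep r i L * sweep r j L = sweep r j L * sweep r i L * r i j := by
  induction L with
  | nil => simp [sweep]
  | cons k L ih =>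
    rw [List.mem_cons, not_or] at hi hj
    rw [List.nodup_cons] at hL
    have hik : Commute (r i k) (sweep r j L) := commute_sweep_right fun l hl =>
      hcomm _ _ _ _ hij (fun h => hi.2 (h ▸ hl)) (Ne.symm hj.1) fun h => hL.1 (h ▸ hl)
    have hjk : Commute (r j k) (sweep r i L) := commute_sweep_right fun l hl =>
      hcomm _ _ _ _ hij.symm (fun h => hj.2 (h ▸ hl)) (Ne.symm hi.1) fun h => hL.1 (h ▸ hl)
    calc r i j * (sweep r i L * r i k) * (sweep r j L * r j k)
        = r i j * sweep r i L * (r i k * sweep r j L) * r j k := by simp only [mul_assoc]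
      _ = (r i j * sweep r i L * sweep r j L) * (r i k * r j k) := by
          rw [hik.eq]; simp only [mul_assoc]
      _ = sweep r j L * sweep r i L * (r i j * r i k * r j k) := by
          rw [ih hL.2 hi.2 hj.2]; simp only [mul_assoc]
      _ = sweep r j L * (sweep r i L * r j k) * (r i k * r i j) := by
          rw [hyb i j k hij hi.1 hj.1]; simp only [mul_assoc]
      _ = sweep r j L * r j k * (sweep r i L * r i k) * r i j := by
          rw [← hjk.eq]; simp only [mul_assoc]

/-- The sweeps of `i` and `j` around the cycle `i, A, j, B` commute. -/
theorem commute_sweep_cycle {r : ι → ι → M}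
    (hcomm : ∀ i j k l, i ≠ k → i ≠ l → j ≠ k → j ≠ l → Commute (r i j) (r k l))
    (hyb : ∀ i j k, i ≠ j → i ≠ k → j ≠ k → r i j * r i k * r j k = r j k * r i k * r i j)
    (hinv : ∀ i j, i ≠ j → r i j * r j i = 1)
    {i j : ι} {A B : List ι} (h : (i :: (A ++ j :: B)).Nodup) :
    Commute (sweep r i (A ++ j :: B)) (sweep r j (B ++ i :: A)) := by
  obtain ⟨hiAB, hAjB⟩ := List.nodup_cons.1 h
  obtain ⟨hA, hjB, hdisj⟩ := List.nodup_append.1 hAjB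
  obtain ⟨hj, hB⟩ := List.nodup_cons.1 hjB
  simp only [List.mem_append, List.mem_cons, not_or] at hiAB
  obtain ⟨hiA, hij, hiB⟩ := hiAB
  have hjA : j ∉ A := fun hm => hdisj j hm j List.mem_cons_self rfl
  have hAB : ∀ a ∈ A, ∀ b ∈ B, a ≠ b := fun a ha b hb => hdisj a ha b (List.mem_cons_of_mem j hb)
  have hBA : Commute (sweep r i B) (sweep r j A) := commute_sweep_sweep fun b hb a ha =>
    hcomm _ _ _ _ hij (fun h => hiA (h ▸ ha)) (fun h => hj (h ▸ hb)) (hAB a ha b hb).symm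
  have hAB' : Commute (sweep r i A) (sweep r j B) := commute_sweep_sweep fun a ha b hb =>
    hcomm _ _ _ _ hij (fun h => hiB (h ▸ hb)) (fun h => hjA (h ▸ ha)) (hAB a ha b hb)
  have exA := mul_sweep_mul_sweep hcomm hyb hij hA hiA hjA
  have exB := mul_sweep_mul_sweep hcomm hyb (Ne.symm hij) hB hj hiB
  simp only [Commute, SemiconjBy, sweep_append, sweep]
  calc sweep r i B * r i j * sweep r i A * (sweep r j A * r j i * sweep r j B)
      = sweep r i B * (r i j * sweep r i A * sweep r j A) * r j i * sweep r j B := by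
        simp only [mul_assoc]
    _ = sweep r i B * sweep r j A * sweep r i A * (r i j * r j i) * sweep r j B := by
        rw [exA]; simp only [mul_assoc]
    _ = (sweep r i B * sweep r j A) * (sweep r i A * sweep r j B) := by
        rw [hinv i j hij]; simp only [mul_assoc, one_mul]
    _ = sweep r j A * sweep r i B * sweep r j B * (r j i * r i j) * sweep r i A := by
        rw [hBA.eq, hAB'.eq, hinv j i (Ne.symm hij)]; simp only [mul_assoc, one_mul]
    _ = sweep r j A * (r j i * sweep r j B * sweep r i B) * r i j * sweep r i A := by
        rw [exB]; simp only [mul_assoc]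
    _ = sweep r j A * r j i * sweep r j B * (sweep r i B * r i j * sweep r i A) := by
        simp only [mul_assoc]

end Exchange

section CyclicList

variable {n : ℕ}

/-- The list `[i + 1, …, i + m]` of indices modulo `n`. -/
def cyclicList (i : Fin n) (m : ℕ) : List (Fin n) :=
  (List.range m).map fun k => i + ⟨(k + 1) % n, Nat.mod_lt _ i.pos⟩

theorem nodup_cons_cyclicList (i : Fin n) : (i :: cyclicList i (n - 1)).Nodup := by
  have : NeZero n := ⟨i.pos.ne'⟩
  have hlt := i.pos
  refine List.nodup_cons.2 ⟨fun h => ?_, ?_⟩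
  · obtain ⟨k, hk, h⟩ := List.mem_map.1 h
    have h0 := congrArg Fin.val (add_eq_left.1 h)
    rw [List.mem_range] at hk
    rw [Fin.val_mk, Nat.mod_eq_of_lt (by omega)] at h0
    simp at h0
  · refine List.Nodup.map_on (fun k hk l hl h => ?_) List.nodup_range
    have h0 := congrArg Fin.val (add_left_cancel h)
    rw [List.mem_range] at hk hl
    simp only [Nat.mod_eq_of_lt (show k + 1 < n by omega),
      Nat.mod_eq_of_lt (show l + 1 < n by omega)] at h0
    omega

theorem cyclicList_eq_append (i j : Fin n) {d e : ℕ} (hde : d + e + 2 = n)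
    (hj : (i + (d + 1)) % n = (j : ℕ)) :
    cyclicList i (n - 1) = cyclicList i d ++ j :: cyclicList j e := by
  have hn : n - 1 = d + (e + 1) := by omega
  rw [cyclicList, hn, List.range_add, List.map_append, List.range_succ_eq_map]
  simp only [cyclicList, List.map_cons, List.map_map, List.append_cancel_left_eq,
    List.cons.injEq, List.map_inj_left]
  refine ⟨Fin.ext ?_, fun k _ => Fin.ext ?_⟩
  · simp [Fin.val_add, hj]
  · simp only [Function.comp_apply, Fin.val_add, ← hj, Nat.add_mod_mod, Nat.mod_add_mod]
    congr 1
    omega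

theorem exists_cyclicList_eq_append {i j : Fin n} (hij : i ≠ j) :
    ∃ A B, cyclicList i (n - 1) = A ++ j :: B ∧ cyclicList j (n - 1) = B ++ i :: A := by
  have hne : (i : ℕ) ≠ j := fun h => hij (Fin.ext h)
  have hi := i.isLt
  have hj := j.isLt
  obtain ⟨d, e, hde, hd, he⟩ : ∃ d e, d + e + 2 = n ∧ ((i : ℕ) + (d + 1)) % n = j ∧
      ((j : ℕ) + (e + 1)) % n = i := by
    rcases Nat.lt_or_gt_of_ne hne with h | h
    · refine ⟨j - i - 1, n - (j - i) - 1, by omega, ?_, ?_⟩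
      · rw [show (i : ℕ) + (j - i - 1 + 1) = j by omega, Nat.mod_eq_of_lt hj]
      · rw [show (j : ℕ) + (n - (j - i) - 1 + 1) = i + n by omega, Nat.add_mod_right,
          Nat.mod_eq_of_lt hi]
    · refine ⟨n - (i - j) - 1, i - j - 1, by omega, ?_, ?_⟩
      · rw [show (i : ℕ) + (n - (i - j) - 1 + 1) = j + n by omega, Nat.add_mod_right,
          Nat.mod_eq_of_lt hj]
      · rw [show (j : ℕ) + (i - j - 1 + 1) = i by omega, Nat.mod_eq_of_lt hi]
  exact ⟨cyclicList i d, cyclicList j e, cyclicList_eq_append i j hde hd,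
    cyclicList_eq_append j i (by omega) he⟩

end CyclicList

section Rij

variable {X : Type*} {n : ℕ}

theorem Rij_comm (R : X × X → X × X) {i j k l : Fin n}
    (hik : i ≠ k) (hil : i ≠ l) (hjk : j ≠ k) (hjl : j ≠ l) (x : Fin n → X) :
    Rij R i j (Rij R k l x) = Rij R k l (Rij R i j x) := by
  funext m
  simp only [Rij]
  grind

theorem Rij_Rij_swap {R : X × X → X × X}
    (hrev : ∀ p : X × X, Prod.swap (R (Prod.swap (R p))) = p)
    {i j : Fin n} (hij : i ≠ j) (x : Fin n → X) : Rij R i j (Rij R j i x) = x := by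
  have h := hrev (x j, x i)
  have h1 : (R ((R (x j, x i)).2, (R (x j, x i)).1)).1 = x i := congrArg Prod.snd h
  have h2 : (R ((R (x j, x i)).2, (R (x j, x i)).1)).2 = x j := congrArg Prod.fst h
  funext m
  simp only [Rij]
  grind

theorem Rij_apply_injective (R : X × X → X × X) {m : ℕ} {e : Fin m → Fin n}
    (he : Function.Injective e) (a b : Fin m) (x : Fin n → X) :
    Rij R (e a) (e b) x ∘ e = Rij R a b (x ∘ e) := by
  funext c
  simp [Rij, he.eq_iff]

theorem Rij_apply_of_ne (R : X × X → X × X) {i j k : Fin n} (hi : k ≠ i) (hj : k ≠ j)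
    (x : Fin n → X) : Rij R i j x k = x k := by
  simp [Rij, hi, hj]

theorem Rij_yangBaxter {R : X × X → X × X}
    (hYB : (Rij R (0 : Fin 3) 1) ∘ (Rij R (0 : Fin 3) 2) ∘ (Rij R (1 : Fin 3) 2) =
           (Rij R (1 : Fin 3) 2) ∘ (Rij R (0 : Fin 3) 2) ∘ (Rij R (0 : Fin 3) 1))
    {i j k : Fin n} (hij : i ≠ j) (hik : i ≠ k) (hjk : j ≠ k) (x : Fin n → X) :
    Rij R i j (Rij R i k (Rij R j k x)) = Rij R j k (Rij R i k (Rij R i j x)) := by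
  obtain ⟨e, he, rfl, rfl, rfl⟩ : ∃ e : Fin 3 → Fin n,
      Function.Injective e ∧ e 0 = i ∧ e 1 = j ∧ e 2 = k := by
    refine ⟨![i, j, k], fun a b => ?_, rfl, rfl, rfl⟩
    fin_cases a <;> fin_cases b <;> simp [hij, hik, hjk, hij.symm, hik.symm, hjk.symm]
  funext m
  by_cases hm : ∃ c, e c = m
  · obtain ⟨c, rfl⟩ := hm
    have h := congrFun (congrFun hYB (x ∘ e)) c
    simp only [Function.comp_apply (g := Rij R _ _ ∘ _), Function.comp_apply (f := Rij R _ _),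
      ← Rij_apply_injective R he] at h
    exact h
  · have hne : ∀ c, m ≠ e c := fun c h => hm ⟨c, h.symm⟩
    simp only [Rij_apply_of_ne R (hne _) (hne _)]

theorem foldl_Rij (R : X × X → X × X) (i : Fin n) (L : List (Fin n)) (x : Fin n → X) :
    L.foldl (fun y k => Rij R i k y) x =
      sweep (M := Function.End (Fin n → X)) (fun i j => Rij R i j) i L x := by
  induction L generalizing x with
  | nil => rfl
  | cons k L ih => exact ih (Rij R i k x)

theorem transfer_eq_sweep (R : X × X → X × X) (i : Fin n) :
    transfer R i = sweep (M := Function.End (Fin n → X)) (fun i j => Rij R i j) i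
      (cyclicList i (n - 1)) := by
  funext x
  rw [← foldl_Rij, cyclicList, List.foldl_map, transfer]

end Rij

/-- If `R` is a reversible Yang–Baxter map, then for every `n ≥ 2` the transfer maps
`T_i^{(n)}`, `i = 1, …, n`, pairwise commute. -/
theorem transfer_maps_commute {X : Type*} (R : X × X → X × X)
    (hYB : (Rij R (0 : Fin 3) 1) ∘ (Rij R (0 : Fin 3) 2) ∘ (Rij R (1 : Fin 3) 2) =
           (Rij R (1 : Fin 3) 2) ∘ (Rij R (0 : Fin 3) 2) ∘ (Rij R (0 : Fin 3) 1))
    (hrev : ∀ p : X × X, Prod.swap (R (Prod.swap (R p))) = p)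
    (n : ℕ) (hn : 2 ≤ n) (i j : Fin n) :
    transfer R i ∘ transfer R j = transfer R j ∘ transfer R i := by
  rcases eq_or_ne i j with rfl | hij
  · rfl
  obtain ⟨A, B, hA, hB⟩ := exists_cyclicList_eq_append hij
  have hnodup := nodup_cons_cyclicList i
  rw [hA] at hnodup
  rw [transfer_eq_sweep, transfer_eq_sweep, hA, hB]
  exact commute_sweep_cycle (M := Function.End (Fin n → X))
    (fun _ _ _ _ h₁ h₂ h₃ h₄ => funext (Rij_comm R h₁ h₂ h₃ h₄))
    (fun _ _ _ h₁ h₂ h₃ => funext (Rij_yangBaxter hYB h₁ h₂ h₃))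
    (fun _ _ h => funext (Rij_Rij_swap hrev h)) hnodup
end

section
/- Let X be a set and R : X × X → X × X a reversible Yang–Baxter map. Then for every n ≥ 2 the transfer maps satisfy T_1^{(n)} ∘ T_2^{(n)} ∘ ⋯ ∘ T_n^{(n)} = Id as maps X^n → X^n. -/
section DescProd

variable {M : Type*} [Monoid M]

/-- The product `f (m - 1) * ⋯ * f 1 * f 0`, with factors in decreasing order of index. -/
def descProd (f : ℕ → M) : ℕ → M
  | 0 => 1
  | m + 1 => f m * descProd f m

theorem descProd_add (f : ℕ → M) (a b : ℕ) :
    descProd f (a + b) = descProd (fun t => f (a + t)) b * descProd f a := by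
  induction b with
  | zero => simp [descProd]
  | succ b ih => rw [← Nat.add_assoc, descProd, descProd, ih, mul_assoc]

theorem descProd_congr {f g : ℕ → M} {m : ℕ} (h : ∀ t < m, f t = g t) :
    descProd f m = descProd g m := by
  induction m with
  | zero => rfl
  | succ m ih =>
    rw [descProd, descProd, h m (Nat.lt_succ_self m), ih fun t ht => h t (Nat.lt_succ_of_lt ht)]

theorem Commute.descProd_right {x : M} {f : ℕ → M} {m : ℕ} (h : ∀ t < m, Commute x (f t)) :
    Commute x (descProd f m) := by
  induction m with
  | zero => exact Commute.one_right x
  | succ m ih =>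
    exact (h m (Nat.lt_succ_self m)).mul_right (ih fun t ht => h t (Nat.lt_succ_of_lt ht))

/-- If `a i * b i = 1` and `c i` commutes with `b j` for `j < i`, then
`(c 0 * a 0) * ⋯ * (c (k - 1) * a (k - 1)) * (b (k - 1) * ⋯ * b 0) = c 0 * ⋯ * c (k - 1)`. -/
theorem prod_range_mul_descProd (a b c : ℕ → M) (k : ℕ) (hab : ∀ i < k, a i * b i = 1)
    (hcb : ∀ i < k, ∀ j < i, Commute (c i) (b j)) :
    ((List.range k).map fun i => c i * a i).prod * descProd b k =
      ((List.range k).map c).prod := by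
  induction k with
  | zero => simp [descProd]
  | succ k ih =>
    have hc : Commute (c k) (descProd b k) :=
      Commute.descProd_right fun j hj => hcb k (Nat.lt_succ_self k) j hj
    rw [List.prod_range_succ, List.prod_range_succ, descProd,
      ← ih (fun i hi => hab i (Nat.lt_succ_of_lt hi))
        (fun i hi => hcb i (Nat.lt_succ_of_lt hi))]
    calc _ = ((List.range k).map fun i => c i * a i).prod *
          (c k * (a k * b k) * descProd b k) := by simp only [mul_assoc]
      _ = _ := by rw [hab k (Nat.lt_succ_self k), mul_one, hc.eq, mul_assoc]

variable {r : ℕ → ℕ → M}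

theorem descProd_cyclic (r : ℕ → ℕ → M) {n i : ℕ} (hi : i < n) :
    descProd (fun t => r i ((i + t + 1) % n)) (n - 1) =
      descProd (r i) i * descProd (fun t => r i (i + 1 + t)) (n - (i + 1)) := by
  rw [show n - 1 = (n - (i + 1)) + i by omega, descProd_add]
  congr 1
  · refine descProd_congr fun t ht => ?_
    rw [show i + (n - (i + 1) + t) + 1 = t + n by omega, Nat.add_mod_right,
      Nat.mod_eq_of_lt (ht.trans hi)]
  · refine descProd_congr fun t ht => ?_
    rw [Nat.mod_eq_of_lt (by omega), Nat.add_right_comm]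

theorem prod_range_descProd_cyclic (hinv : ∀ i j, i ≠ j → r i j * r j i = 1)
    (hcomm : ∀ i j k l, i ≠ k → i ≠ l → j ≠ k → j ≠ l → Commute (r i j) (r k l))
    {n k : ℕ} (hk : k ≤ n) :
    ((List.range k).map fun i => descProd (fun t => r i ((i + t + 1) % n)) (n - 1)).prod =
      ((List.range k).map fun i => descProd (fun t => r i (k + t)) (n - k)).prod := by
  induction k with
  | zero => rfl
  | succ k ih =>
    have hsplit : ∀ i, descProd (fun t => r i (k + t)) (n - k) =
        descProd (fun t => r i (k + 1 + t)) (n - (k + 1)) * r i k := fun i => by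
      rw [show n - k = 1 + (n - (k + 1)) by omega, descProd_add]
      simp [descProd, Nat.add_assoc]
    rw [List.prod_range_succ, List.prod_range_succ, ih (Nat.le_of_succ_le hk),
      descProd_cyclic r hk, ← mul_assoc]
    simp only [hsplit]
    rw [prod_range_mul_descProd (fun i => r i k) (r k)
      (fun i => descProd (fun t => r i (k + 1 + t)) (n - (k + 1))) k
      (fun i hi => hinv i k hi.ne) fun i hi j hj => ?_]
    exact (Commute.descProd_right fun t _ =>
      hcomm k j i (k + 1 + t) (by omega) (by omega) (by omega) (by omega)).symm

end DescProd

section Transfer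

variable {X : Type*} {n : ℕ}

theorem Rij_comp_Rij_swap {R : X × X → X × X}
    (hrev : ∀ p : X × X, Prod.swap (R (Prod.swap (R p))) = p) {i j : Fin n} (hij : i ≠ j) :
    Rij R i j ∘ Rij R j i = id := by
  funext x k
  have h := hrev (x j, x i)
  have h₁ := congrArg Prod.fst h
  have h₂ := congrArg Prod.snd h
  simp only [Prod.swap] at h₁ h₂
  by_cases hki : k = i
  · subst hki; simp [Rij, hij, h₂]
  · by_cases hkj : k = j
    · subst hkj; simp [Rij, hij, hij.symm, h₁]
    · simp [Rij, hki, hkj]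

theorem Rij_comp_comm (R : X × X → X × X) {i j k l : Fin n}
    (hik : i ≠ k) (hil : i ≠ l) (hjk : j ≠ k) (hjl : j ≠ l) :
    Rij R i j ∘ Rij R k l = Rij R k l ∘ Rij R i j := by
  funext x m
  simp only [Function.comp, Rij]
  grind

/-- `Rij` as an element of the monoid of self-maps of `Xⁿ`, extended by the identity to all
pairs of natural numbers. -/
def rijEnd (R : X × X → X × X) (n i j : ℕ) : Function.End (Fin n → X) :=
  if h : i < n ∧ j < n then Rij R ⟨i, h.1⟩ ⟨j, h.2⟩ else 1

theorem rijEnd_of_lt (R : X × X → X × X) {i j : ℕ} (hi : i < n) (hj : j < n) :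
    rijEnd R n i j = Rij R ⟨i, hi⟩ ⟨j, hj⟩ :=
  dif_pos ⟨hi, hj⟩

theorem rijEnd_of_not_lt (R : X × X → X × X) {i j : ℕ} (h : ¬(i < n ∧ j < n)) :
    rijEnd R n i j = 1 :=
  dif_neg h

theorem rijEnd_mul_swap {R : X × X → X × X}
    (hrev : ∀ p : X × X, Prod.swap (R (Prod.swap (R p))) = p) {i j : ℕ} (hij : i ≠ j) :
    rijEnd R n i j * rijEnd R n j i = 1 := by
  by_cases h : i < n ∧ j < n
  · change rijEnd R n i j ∘ rijEnd R n j i = id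
    rw [rijEnd_of_lt R h.1 h.2, rijEnd_of_lt R h.2 h.1]
    exact Rij_comp_Rij_swap hrev fun e => hij (congrArg Fin.val e)
  · rw [rijEnd_of_not_lt R h, rijEnd_of_not_lt R fun h' => h h'.symm, one_mul]

theorem rijEnd_commute (R : X × X → X × X) {i j k l : ℕ}
    (hik : i ≠ k) (hil : i ≠ l) (hjk : j ≠ k) (hjl : j ≠ l) :
    Commute (rijEnd R n i j) (rijEnd R n k l) := by
  by_cases h : i < n ∧ j < n
  · by_cases h' : k < n ∧ l < n
    · change rijEnd R n i j ∘ rijEnd R n k l = rijEnd R n k l ∘ rijEnd R n i j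
      rw [rijEnd_of_lt R h.1 h.2, rijEnd_of_lt R h'.1 h'.2]
      exact Rij_comp_comm R (fun e => hik (congrArg Fin.val e))
        (fun e => hil (congrArg Fin.val e)) (fun e => hjk (congrArg Fin.val e))
        (fun e => hjl (congrArg Fin.val e))
    · rw [rijEnd_of_not_lt R h']
      exact Commute.one_right _
  · rw [rijEnd_of_not_lt R h]
    exact Commute.one_left _

theorem transfer_eq_descProd (R : X × X → X × X) (i : Fin n) :
    transfer R i =
      descProd (fun t => rijEnd R n i ((i + t + 1) % n)) (n - 1) := by
  funext x
  unfold transfer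
  generalize n - 1 = m
  induction m with
  | zero => rfl
  | succ m ih =>
    have hlt : (i + m + 1) % n < n := Nat.mod_lt _ i.pos
    have hidx : i + (⟨(m + 1) % n, Nat.mod_lt _ i.pos⟩ : Fin n) = ⟨(i + m + 1) % n, hlt⟩ := by
      ext
      simp [Fin.val_add, Nat.add_assoc]
    rw [List.range_succ, List.foldl_append, ih, List.foldl_cons, List.foldl_nil, hidx]
    exact (congrFun (rijEnd_of_lt R i.isLt hlt) _).symm

end Transfer

/-- If `R` is a reversible Yang–Baxter map, then for every `n ≥ 2` the transfer maps
satisfy `T_1^{(n)} ∘ T_2^{(n)} ∘ ⋯ ∘ T_n^{(n)} = Id` (the rightmost map `T_n^{(n)}`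
is applied first). -/
theorem transfer_maps_product_id {X : Type*} (R : X × X → X × X)
    (hYB : (Rij R (0 : Fin 3) 1) ∘ (Rij R (0 : Fin 3) 2) ∘ (Rij R (1 : Fin 3) 2) =
           (Rij R (1 : Fin 3) 2) ∘ (Rij R (0 : Fin 3) 2) ∘ (Rij R (0 : Fin 3) 1))
    (hrev : ∀ p : X × X, Prod.swap (R (Prod.swap (R p))) = p)
    (n : ℕ) (hn : 2 ≤ n) :
    (List.finRange n).foldr (fun i F => transfer R i ∘ F) id = id := by
  let T : ℕ → Function.End (Fin n → X) :=
    fun i => descProd (fun t => rijEnd R n i ((i + t + 1) % n)) (n - 1)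
  have hfold : ∀ l : List (Fin n), l.foldr (fun i F => transfer R i ∘ F) id =
      ((l.map Fin.val).map T).prod := fun l => by
    induction l with
    | nil => rfl
    | cons i l ih =>
      rw [List.foldr_cons, ih, List.map_cons, List.map_cons, List.prod_cons,
        transfer_eq_descProd]
      rfl
  rw [hfold, List.map_coe_finRange_eq_range]
  refine (prod_range_descProd_cyclic (fun _ _ => rijEnd_mul_swap hrev)
    (fun _ _ _ _ => rijEnd_commute R) le_rfl).trans ?_
  simp only [Nat.sub_self, descProd]
  exact List.prod_eq_one (by simp)
end

section
/- Let G be a group acting faithfully on a set X (i.e. if g•x = h•x for all x ∈ X then g = h), let Λ be a set of parameters, and let R(λ,μ) : X × X → X × X be a family of maps satisfying the parameter-dependent Yang–Baxter relation. Suppose R has the special form R(λ,μ)(x,y) = (B(y,μ,λ)•x, A(x,λ,μ)•y) for some functions A, B : X × Λ × Λ → G. Then A is a Lax matrix for R: for all λ, μ, ν ∈ Λ and x, y ∈ X, A(x,λ,ν)·A(y,μ,ν) = A(y₁,μ,ν)·A(x₂,λ,ν) in G, where (x₂, y₁) = R(λ,μ)(x,y). -/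
/-- Let a group `G` act faithfully on `X` and let `R (λ, μ)` be a family of maps
satisfying the parameter-dependent Yang–Baxter relation, of the special form
`R (λ, μ) (x, y) = (B (y, μ, λ) • x, A (x, λ, μ) • y)`. Then `A` is a Lax matrix for `R`:
`A (x, λ, ν) · A (y, μ, ν) = A (y₁, μ, ν) · A (x₂, λ, ν)` where `(x₂, y₁) = R (λ, μ) (x, y)`. -/
theorem lax_from_special_form_A {G X Λ : Type*} [Group G] [MulAction G X]
    (hfaithful : ∀ g h : G, (∀ x : X, g • x = h • x) → g = h)
    (R : Λ → Λ → X × X → X × X)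
    (hYB : ∀ l₁ l₂ l₃ : Λ,
      (Rij (R l₁ l₂) (0 : Fin 3) 1) ∘ (Rij (R l₁ l₃) (0 : Fin 3) 2) ∘
          (Rij (R l₂ l₃) (1 : Fin 3) 2) =
        (Rij (R l₂ l₃) (1 : Fin 3) 2) ∘ (Rij (R l₁ l₃) (0 : Fin 3) 2) ∘
          (Rij (R l₁ l₂) (0 : Fin 3) 1))
    (A B : X → Λ → Λ → G)
    (hform : ∀ (lam mu : Λ) (x y : X), R lam mu (x, y) = (B y mu lam • x, A x lam mu • y)) :
    ∀ (lam mu nu : Λ) (x y : X),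
      A x lam nu * A y mu nu =
        A (R lam mu (x, y)).2 mu nu * A (R lam mu (x, y)).1 lam nu := by
  intro lam mu nu x y
  refine hfaithful _ _ fun z => ?_
  have h := congrFun (congrFun (hYB lam mu nu) ![x, y, z]) 2
  simpa [Rij, hform, mul_smul] using h
end

section
/- Let G be a group acting faithfully on a set X (i.e. if g•x = h•x for all x ∈ X then g = h), let Λ be a set of parameters, and let R(λ,μ) : X × X → X × X be a family of maps satisfying the parameter-dependent Yang–Baxter relation. Suppose R has the special form R(λ,μ)(x,y) = (B(y,μ,λ)•x, A(x,λ,μ)•y) for some functions A, B : X × Λ × Λ → G. Then B satisfies the refactorization relation of R with reversed roles: for all λ, μ, ν ∈ Λ and y, z ∈ X, B(z,ν,λ)·B(y,μ,λ) = B(y₃,μ,λ)·B(z₂,ν,λ) in G, where (y₃, z₂) = R(μ,ν)(y,z). -/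
/-- Let a group `G` act faithfully on `X` and let `R (λ, μ)` be a family of maps
satisfying the parameter-dependent Yang–Baxter relation, of the special form
`R (λ, μ) (x, y) = (B (y, μ, λ) • x, A (x, λ, μ) • y)`. Then `B` satisfies the
refactorization relation with reversed roles:
`B (z, ν, λ) · B (y, μ, λ) = B (y₃, μ, λ) · B (z₂, ν, λ)` where `(y₃, z₂) = R (μ, ν) (y, z)`. -/
theorem lax_from_special_form_B {G X Λ : Type*} [Group G] [MulAction G X]
    (hfaithful : ∀ g h : G, (∀ x : X, g • x = h • x) → g = h)
    (R : Λ → Λ → X × X → X × X)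
    (hYB : ∀ l₁ l₂ l₃ : Λ,
      (Rij (R l₁ l₂) (0 : Fin 3) 1) ∘ (Rij (R l₁ l₃) (0 : Fin 3) 2) ∘
          (Rij (R l₂ l₃) (1 : Fin 3) 2) =
        (Rij (R l₂ l₃) (1 : Fin 3) 2) ∘ (Rij (R l₁ l₃) (0 : Fin 3) 2) ∘
          (Rij (R l₁ l₂) (0 : Fin 3) 1))
    (A B : X → Λ → Λ → G)
    (hform : ∀ (lam mu : Λ) (x y : X), R lam mu (x, y) = (B y mu lam • x, A x lam mu • y)) :
    ∀ (lam mu nu : Λ) (y z : X),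
      B z nu lam * B y mu lam =
        B (R mu nu (y, z)).1 mu lam * B (R mu nu (y, z)).2 nu lam := by
  intro lam mu nu y z
  refine hfaithful _ _ fun x => ?_
  have h := congrFun (congrFun (hYB lam mu nu) ![x, y, z]) 0
  simpa [Rij, hform, mul_smul] using h.symm
end

section
/- Let K be a field, f₁, f₂, β₁, β₂ ∈ K with f₁ + f₂ ≠ 0, and set f̃₁ = f₂ − (β₁ − β₂)/(f₁ + f₂) and f̃₂ = f₁ − (β₂ − β₁)/(f₁ + f₂). Then for every ζ ∈ K the 2×2 matrix identity A(f₁, β₁; ζ)·A(f₂, β₂; ζ) = A(f̃₂, β₂; ζ)·A(f̃₁, β₁; ζ) holds, where A(f, β; ζ) denotes the 2×2 matrix with rows (f, f² + β − ζ) and (1, f). -/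
/-- The Lax matrix `A (f, β; ζ) = [[f, f² + β − ζ], [1, f]]` of the Adler map. -/
def adlerLax {K : Type*} [Field K] (f β ζ : K) : Matrix (Fin 2) (Fin 2) K :=
  !![f, f ^ 2 + β - ζ; 1, f]

/-- The refactorization identity for the Adler map: with `f̃₁ = f₂ − (β₁ − β₂)/(f₁ + f₂)`
and `f̃₂ = f₁ − (β₂ − β₁)/(f₁ + f₂)` one has
`A (f₁, β₁; ζ) · A (f₂, β₂; ζ) = A (f̃₂, β₂; ζ) · A (f̃₁, β₁; ζ)` for all `ζ`. -/
theorem adler_lax_refactorization {K : Type*} [Field K]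
    (f₁ f₂ β₁ β₂ : K) (h : f₁ + f₂ ≠ 0) (ζ : K) :
    adlerLax f₁ β₁ ζ * adlerLax f₂ β₂ ζ =
      adlerLax (f₁ - (β₂ - β₁) / (f₁ + f₂)) β₂ ζ *
        adlerLax (f₂ - (β₁ - β₂) / (f₁ + f₂)) β₁ ζ := by
  obtain ⟨d, hd⟩ : ∃ d, d = (β₁ - β₂) / (f₁ + f₂) := ⟨_, rfl⟩
  have hβ : β₁ = β₂ + d * (f₁ + f₂) := by
    rw [hd, div_mul_cancel₀ _ h]
    ring
  rw [← neg_sub β₁ β₂, neg_div, ← hd, hβ]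
  ext i j
  fin_cases i <;> fin_cases j <;> simp [adlerLax, Matrix.mul_apply, Fin.sum_univ_two] <;> ring
end

section
/- Let K be a field and β₁, β₂, β₃ ∈ K. For β, β' ∈ K write R(β,β')(u,v) = (v − (β − β')/(u+v), u − (β' − β)/(u+v)) (the Adler map, defined when u + v ≠ 0). Let x, y, z ∈ K and define: (y₃, z₂) = R(β₂,β₃)(y,z), (x₃, z₁₂) = R(β₁,β₃)(x,z₂), (x₂₃, y₁₃) = R(β₁,β₂)(x₃,y₃); and (x₂, y₁) = R(β₁,β₂)(x,y), (x₂₃', z₁) = R(β₁,β₃)(x₂,z), (y₁₃', z₁₂') = R(β₂,β₃)(y₁,z₁). Assume that the six denominators y+z, x+z₂, x₃+y₃, x+y, x₂+z, y₁+z₁ are all nonzero. Then x₂₃ = x₂₃', y₁₃ = y₁₃', and z₁₂ = z₁₂', i.e. the Adler map satisfies the parameter-dependent Yang–Baxter relation wherever both composites are defined. -/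
/-- The Adler map with parameters `β, β'`:
`R (β, β') (u, v) = (v − (β − β')/(u + v), u − (β' − β)/(u + v))`. -/
def adlerMap {K : Type*} [Field K] (β β' : K) (p : K × K) : K × K :=
  (p.2 - (β - β') / (p.1 + p.2), p.1 - (β' - β) / (p.1 + p.2))

/-- The Adler map satisfies the parameter-dependent Yang–Baxter relation wherever
both composite chains are defined. -/
theorem adler_yang_baxter {K : Type*} [Field K] (β₁ β₂ β₃ x y z : K)
    (y₃ z₂ x₃ z₁₂ x₂₃ y₁₃ x₂ y₁ x₂₃' z₁ y₁₃' z₁₂' : K)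
    (h1 : (y₃, z₂) = adlerMap β₂ β₃ (y, z))
    (h2 : (x₃, z₁₂) = adlerMap β₁ β₃ (x, z₂))
    (h3 : (x₂₃, y₁₃) = adlerMap β₁ β₂ (x₃, y₃))
    (h4 : (x₂, y₁) = adlerMap β₁ β₂ (x, y))
    (h5 : (x₂₃', z₁) = adlerMap β₁ β₃ (x₂, z))
    (h6 : (y₁₃', z₁₂') = adlerMap β₂ β₃ (y₁, z₁))
    (d1 : y + z ≠ 0) (d2 : x + z₂ ≠ 0) (d3 : x₃ + y₃ ≠ 0)
    (d4 : x + y ≠ 0) (d5 : x₂ + z ≠ 0) (d6 : y₁ + z₁ ≠ 0) :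
    x₂₃ = x₂₃' ∧ y₁₃ = y₁₃' ∧ z₁₂ = z₁₂' := by
  simp only [adlerMap, Prod.mk.injEq] at h1 h2 h3 h4 h5 h6
  obtain ⟨rfl, rfl⟩ := h1
  obtain ⟨rfl, rfl⟩ := h2
  obtain ⟨rfl, rfl⟩ := h3
  obtain ⟨rfl, rfl⟩ := h4
  obtain ⟨rfl, rfl⟩ := h5
  obtain ⟨rfl, rfl⟩ := h6
  -- All six denominators are built from `y + z`, `x + y`, `P` and `Q`.
  obtain ⟨P, hP⟩ : ∃ P, P = (x + y) * (y + z) + (β₂ - β₃) := ⟨_, rfl⟩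
  obtain ⟨Q, hQ⟩ : ∃ Q, Q = (x + y) * (y + z) - (β₁ - β₂) := ⟨_, rfl⟩
  have e2 : x + (y - (β₃ - β₂) / (y + z)) = P / (y + z) := by
    rw [hP]; field_simp; ring
  have e5 : y - (β₁ - β₂) / (x + y) + z = Q / (x + y) := by
    rw [hQ]; field_simp; ring
  rw [e2] at d2 d3 ⊢
  rw [e5] at d5 d6 ⊢
  have hP0 : P ≠ 0 := (div_ne_zero_iff.mp d2).1
  have hQ0 : Q ≠ 0 := (div_ne_zero_iff.mp d5).1
  have e3 : y - (β₃ - β₂) / (y + z) - (β₁ - β₃) / (P / (y + z)) +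
      (z - (β₂ - β₃) / (y + z)) = (y + z) * Q / P := by
    field_simp; rw [hP, hQ]; ring
  have e6 : x - (β₂ - β₁) / (x + y) + (y - (β₁ - β₂) / (x + y) -
      (β₃ - β₁) / (Q / (x + y))) = (x + y) * P / Q := by
    field_simp; rw [hP, hQ]; ring
  rw [e3, e6]
  refine ⟨?_, ?_, ?_⟩ <;> field_simp <;> rw [hP, hQ] <;> ring
end

section
/- Let K be a field, d ≥ 1, λ₁, λ₂ ∈ K with λ₁ ≠ λ₂, and let ξ₁, ξ₂ ∈ K^d be column vectors and η₁, η₂ ∈ K^d covectors, with pairings (ξ,η) = Σᵢ ξᵢηᵢ. Assume (ξ₁,η₁) ≠ 0 and (ξ₂,η₂) ≠ 0, and define ξ̃₁ = ξ₁ + (2λ₂(ξ₁,η₂)/((λ₁−λ₂)(ξ₂,η₂)))·ξ₂, η̃₁ = η₁ + (2λ₂(ξ₂,η₁)/((λ₁−λ₂)(ξ₂,η₂)))·η₂, ξ̃₂ = ξ₂ + (2λ₁(ξ₂,η₁)/((λ₂−λ₁)(ξ₁,η₁)))·ξ₁, η̃₂ = η₂ + (2λ₁(ξ₁,η₂)/((λ₂−λ₁)(ξ₁,η₁)))·η₁.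 Assume also (ξ̃₁,η̃₁) ≠ 0 and (ξ̃₂,η̃₂) ≠ 0. Let Pᵢ = (1/(ξᵢ,ηᵢ))·(ξᵢ ⊗ ηᵢ) and P̃ᵢ = (1/(ξ̃ᵢ,η̃ᵢ))·(ξ̃ᵢ ⊗ η̃ᵢ) be the corresponding rank-one d×d matrices. Then for every ζ ∈ K: ((ζ−λ₁)·I + 2λ₁·P₁)·((ζ−λ₂)·I + 2λ₂·P₂) = ((ζ−λ₂)·I + 2λ₂·P̃₂)·((ζ−λ₁)·I + 2λ₁·P̃₁). -/
open Matrix in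
/-- The product of two affine rank-one matrices, entrywise. -/
theorem Matrix.smul_one_add_smul_vecMulVec_mul_apply {n K : Type*} [Fintype n] [DecidableEq n]
    [CommRing K] (α β s t : K) (u v w z : n → K) (i j : n) :
    ((α • (1 : Matrix n n K) + s • vecMulVec u v) *
        (β • (1 : Matrix n n K) + t • vecMulVec w z)) i j =
      α * β * (1 : Matrix n n K) i j + α * t * (w i * z j) + β * s * (u i * v j) +
        s * t * (w ⬝ᵥ v) * (u i * z j) := by
  simp only [add_mul, mul_add, smul_mul_smul_comm, one_mul, mul_one, vecMulVec_mul_vecMulVec,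
    Matrix.add_apply, Matrix.smul_apply, vecMulVec_apply, smul_eq_mul, Pi.smul_apply,
    dotProduct_comm w v]
  ring

open Matrix in
/-- The refactorization identity for the interaction of two matrix KdV solitons with
rank-one polarization projectors `Pᵢ = ξᵢ ⊗ ηᵢ / (ξᵢ, ηᵢ)`: with the soliton interaction
formulas for the new polarizations `ξ̃ᵢ, η̃ᵢ`, one has for every `ζ`
`((ζ−λ₁)·I + 2λ₁·P₁)·((ζ−λ₂)·I + 2λ₂·P₂) = ((ζ−λ₂)·I + 2λ₂·P̃₂)·((ζ−λ₁)·I + 2λ₁·P̃₁)`. -/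
theorem matrix_kdv_soliton_refactorization {K : Type*} [Field K] (d : ℕ) (hd : 1 ≤ d)
    (l₁ l₂ : K) (hl : l₁ ≠ l₂)
    (ξ₁ ξ₂ η₁ η₂ : Fin d → K)
    (h11 : ∑ i, ξ₁ i * η₁ i ≠ 0) (h22 : ∑ i, ξ₂ i * η₂ i ≠ 0)
    (ξt₁ ηt₁ ξt₂ ηt₂ : Fin d → K)
    (hξt₁ : ξt₁ = ξ₁ +
      (2 * l₂ * (∑ i, ξ₁ i * η₂ i) / ((l₁ - l₂) * ∑ i, ξ₂ i * η₂ i)) • ξ₂)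
    (hηt₁ : ηt₁ = η₁ +
      (2 * l₂ * (∑ i, ξ₂ i * η₁ i) / ((l₁ - l₂) * ∑ i, ξ₂ i * η₂ i)) • η₂)
    (hξt₂ : ξt₂ = ξ₂ +
      (2 * l₁ * (∑ i, ξ₂ i * η₁ i) / ((l₂ - l₁) * ∑ i, ξ₁ i * η₁ i)) • ξ₁)
    (hηt₂ : ηt₂ = η₂ +
      (2 * l₁ * (∑ i, ξ₁ i * η₂ i) / ((l₂ - l₁) * ∑ i, ξ₁ i * η₁ i)) • η₁)
    (ht1 : ∑ i, ξt₁ i * ηt₁ i ≠ 0) (ht2 : ∑ i, ξt₂ i * ηt₂ i ≠ 0)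
    (ζ : K) :
    ((ζ - l₁) • (1 : Matrix (Fin d) (Fin d) K) +
        (2 * l₁) • ((∑ i, ξ₁ i * η₁ i)⁻¹ • vecMulVec ξ₁ η₁)) *
      ((ζ - l₂) • (1 : Matrix (Fin d) (Fin d) K) +
        (2 * l₂) • ((∑ i, ξ₂ i * η₂ i)⁻¹ • vecMulVec ξ₂ η₂)) =
    ((ζ - l₂) • (1 : Matrix (Fin d) (Fin d) K) +
        (2 * l₂) • ((∑ i, ξt₂ i * ηt₂ i)⁻¹ • vecMulVec ξt₂ ηt₂)) *
      ((ζ - l₁) • (1 : Matrix (Fin d) (Fin d) K) +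
        (2 * l₁) • ((∑ i, ξt₁ i * ηt₁ i)⁻¹ • vecMulVec ξt₁ ηt₁)) := by
  have hδ : l₁ - l₂ ≠ 0 := sub_ne_zero.mpr hl
  have hδ_neg : l₂ - l₁ = -(l₁ - l₂) := by ring
  change ξ₁ ⬝ᵥ η₁ ≠ 0 at h11
  change ξ₂ ⬝ᵥ η₂ ≠ 0 at h22
  change ξt₁ ⬝ᵥ ηt₁ ≠ 0 at ht1
  change ξt₁ = ξ₁ + (2 * l₂ * (ξ₁ ⬝ᵥ η₂) / ((l₁ - l₂) * (ξ₂ ⬝ᵥ η₂))) • ξ₂ at hξt₁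
  change ηt₁ = η₁ + (2 * l₂ * (ξ₂ ⬝ᵥ η₁) / ((l₁ - l₂) * (ξ₂ ⬝ᵥ η₂))) • η₂ at hηt₁
  change ξt₂ = ξ₂ + (2 * l₁ * (ξ₂ ⬝ᵥ η₁) / ((l₂ - l₁) * (ξ₁ ⬝ᵥ η₁))) • ξ₁ at hξt₂
  change ηt₂ = η₂ + (2 * l₁ * (ξ₁ ⬝ᵥ η₂) / ((l₂ - l₁) * (ξ₁ ⬝ᵥ η₁))) • η₁ at hηt₂
  change (_ + (2 * l₁) • ((ξ₁ ⬝ᵥ η₁)⁻¹ • _)) * (_ + (2 * l₂) • ((ξ₂ ⬝ᵥ η₂)⁻¹ • _)) =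
    (_ + (2 * l₂) • ((ξt₂ ⬝ᵥ ηt₂)⁻¹ • _)) * (_ + (2 * l₁) • ((ξt₁ ⬝ᵥ ηt₁)⁻¹ • _))
  rw [hδ_neg] at hξt₂ hηt₂
  -- All pairings of the new polarizations share the factor `c`.
  obtain ⟨c, hc⟩ : ∃ c, c = 1 + 4 * l₁ * l₂ * (ξ₁ ⬝ᵥ η₂) * (ξ₂ ⬝ᵥ η₁) /
    ((l₁ - l₂) ^ 2 * (ξ₁ ⬝ᵥ η₁) * (ξ₂ ⬝ᵥ η₂)) := ⟨_, rfl⟩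
  have pair11 : ξt₁ ⬝ᵥ ηt₁ = (ξ₁ ⬝ᵥ η₁) * c := by
    simp only [hξt₁, hηt₁, hc, add_dotProduct, dotProduct_add, smul_dotProduct, dotProduct_smul,
      smul_eq_mul]
    field_simp
    ring
  have pair22 : ξt₂ ⬝ᵥ ηt₂ = (ξ₂ ⬝ᵥ η₂) * c := by
    simp only [hξt₂, hηt₂, hc, add_dotProduct, dotProduct_add, smul_dotProduct, dotProduct_smul,
      smul_eq_mul]
    field_simp
    ring
  have pair12 : ξt₁ ⬝ᵥ ηt₂ = -((ξ₁ ⬝ᵥ η₂) * c) := by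
    simp only [hξt₁, hηt₂, hc, add_dotProduct, dotProduct_add, smul_dotProduct, dotProduct_smul,
      smul_eq_mul]
    field_simp
    ring
  have hc0 : c ≠ 0 := right_ne_zero_of_mul (pair11 ▸ ht1)
  ext i j
  simp only [smul_smul, Matrix.smul_one_add_smul_vecMulVec_mul_apply, pair11, pair22, pair12]
  simp only [hξt₁, hηt₁, hξt₂, hηt₂, Pi.add_apply, Pi.smul_apply, smul_eq_mul]
  generalize ξ₁ ⬝ᵥ η₁ = a at *
  generalize ξ₂ ⬝ᵥ η₂ = b at *
  generalize ξ₁ ⬝ᵥ η₂ = p at *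
  generalize ξ₂ ⬝ᵥ η₁ = q at *
  have hN : (l₁ - l₂) ^ 2 * a * b * c = (l₁ - l₂) ^ 2 * a * b + 4 * l₁ * l₂ * p * q := by
    rw [hc]
    field_simp
  clear hc pair11 pair12 pair22 ht1 ht2 hξt₁ hηt₁ hξt₂ hηt₂
  field_simp
  linear_combination ((ζ - l₁) * l₂ * 2 * ξ₂ i * η₂ j * a + l₁ * (ζ - l₂) * 2 * b * ξ₁ i * η₁ j +
    l₁ * l₂ * 2 ^ 2 * η₂ j * ξ₁ i * q) * hN
end

section
/- Let G be a group. Define the relation r on G × G by: (g₁,g₂) r (h₁,h₂) iff g₁g₂ = h₂h₁, and for distinct i,j ∈ {1,2,3} define the relation r_{ij} on G³ relating two triples iff they agree in the coordinate outside {i,j} and their (i,j)-components are related by r (with i playing the role of the first argument). Then: (a) the relational composite r₁₂ ∘ r₁₃ ∘ r₂₃ (applying r₂₃ first) equals the relational composite r₂₃ ∘ r₁₃ ∘ r₁₂ (applying r₁₂ first), and both equal the relation relating (g₁,g₂,g₃) to (h₁,h₂,h₃) iff g₁g₂g₃ = h₃h₂h₁; (b) r is reversible as a correspondence: (g₁,g₂)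 r (h₁,h₂) iff (h₂,h₁) r (g₂,g₁). In particular r is a reversible Yang–Baxter correspondence. -/
/-- The factorization correspondence of a group `G`: `(g₁, g₂) r (h₁, h₂)` iff
`g₁ g₂ = h₂ h₁`. -/
def factorRel {G : Type*} [Group G] : G × G → G × G → Prop :=
  fun p q => p.1 * p.2 = q.2 * q.1

/-- `r₁₂` on `G³`: the third coordinate is fixed and the first two are related by `r`. -/
def factorRel12 {G : Type*} [Group G] : G × G × G → G × G × G → Prop :=
  fun g h => g.2.2 = h.2.2 ∧ factorRel (g.1, g.2.1) (h.1, h.2.1)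

/-- `r₁₃` on `G³`: the second coordinate is fixed and the first and third are related
by `r`. -/
def factorRel13 {G : Type*} [Group G] : G × G × G → G × G × G → Prop :=
  fun g h => g.2.1 = h.2.1 ∧ factorRel (g.1, g.2.2) (h.1, h.2.2)

/-- `r₂₃` on `G³`: the first coordinate is fixed and the last two are related by `r`. -/
def factorRel23 {G : Type*} [Group G] : G × G × G → G × G × G → Prop :=
  fun g h => g.1 = h.1 ∧ factorRel (g.2.1, g.2.2) (h.2.1, h.2.2)

/-- Composing `r₂₃`, `r₁₃`, `r₁₂` in this order gives the threefold factorization relation. -/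
theorem comp_factorRel23_factorRel13_factorRel12 {G : Type*} [Group G] :
    Relation.Comp (Relation.Comp (factorRel23 (G := G)) factorRel13) factorRel12 =
      fun (g h : G × G × G) => g.1 * g.2.1 * g.2.2 = h.2.2 * h.2.1 * h.1 := by
  ext ⟨g₁, g₂, g₃⟩ ⟨h₁, h₂, h₃⟩
  simp only [Relation.Comp, factorRel12, factorRel13, factorRel23, factorRel]
  constructor
  · rintro ⟨⟨c, a, d⟩, ⟨⟨g₁, a, b⟩, ⟨rfl, hab⟩, rfl, hcd⟩, rfl, hca⟩
    dsimp only at *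
    rw [mul_assoc, hab, ← mul_assoc, hcd, mul_assoc, hca, mul_assoc]
  · intro h
    exact ⟨(h₂ * h₁, 1, h₃), ⟨(g₁, 1, g₂ * g₃), by simp, by simpa [mul_assoc] using h⟩, by simp⟩

/-- Composing `r₁₂`, `r₁₃`, `r₂₃` in this order gives the threefold factorization relation. -/
theorem comp_factorRel12_factorRel13_factorRel23 {G : Type*} [Group G] :
    Relation.Comp (Relation.Comp (factorRel12 (G := G)) factorRel13) factorRel23 =
      fun (g h : G × G × G) => g.1 * g.2.1 * g.2.2 = h.2.2 * h.2.1 * h.1 := by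
  ext ⟨g₁, g₂, g₃⟩ ⟨h₁, h₂, h₃⟩
  simp only [Relation.Comp, factorRel12, factorRel13, factorRel23, factorRel]
  constructor
  · rintro ⟨⟨c, b, d⟩, ⟨⟨a, b, g₃⟩, ⟨rfl, hab⟩, rfl, hcd⟩, rfl, hbd⟩
    dsimp only at *
    rw [hab, mul_assoc, hcd, ← mul_assoc, hbd]
  · intro h
    exact ⟨(h₁, 1, h₃ * h₂), ⟨(g₁ * g₂, 1, g₃), by simp, by simpa using h⟩, by simp⟩

/-- For any group `G` the factorization correspondence `(g₁,g₂) r (h₁,h₂) ⟺ g₁g₂ = h₂h₁`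
is a reversible Yang–Baxter correspondence:
(a) the relational composites `r₁₂ ∘ r₁₃ ∘ r₂₃` (applying `r₂₃` first) and
`r₂₃ ∘ r₁₃ ∘ r₁₂` (applying `r₁₂` first) coincide, and both equal the relation
`(g₁,g₂,g₃) ∼ (h₁,h₂,h₃) ⟺ g₁g₂g₃ = h₃h₂h₁`;
(b) `r` is reversible: `(g₁,g₂) r (h₁,h₂) ⟺ (h₂,h₁) r (g₂,g₁)`. -/
theorem factor_correspondence_yang_baxter {G : Type*} [Group G] :
    (Relation.Comp (Relation.Comp (factorRel23 (G := G)) (factorRel13 (G := G)))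
          (factorRel12 (G := G)) =
        Relation.Comp (Relation.Comp (factorRel12 (G := G)) (factorRel13 (G := G)))
          (factorRel23 (G := G)) ∧
      Relation.Comp (Relation.Comp (factorRel23 (G := G)) (factorRel13 (G := G)))
          (factorRel12 (G := G)) =
        fun (g h : G × G × G) => g.1 * g.2.1 * g.2.2 = h.2.2 * h.2.1 * h.1) ∧
    (∀ g₁ g₂ h₁ h₂ : G, factorRel (g₁, g₂) (h₁, h₂) ↔ factorRel (h₂, h₁) (g₂, g₁)) := by
  exact ⟨⟨comp_factorRel23_factorRel13_factorRel12.trans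
    comp_factorRel12_factorRel13_factorRel23.symm,
    comp_factorRel23_factorRel13_factorRel12⟩, fun _ _ _ _ => eq_comm⟩
end

section
/- Let K be a field and α, β, γ ∈ K. For parameters α, β define the map F_I(α,β)(x,y) = (α·y·P, β·x·P) with P = ((1−β)x + β − α + (α−1)y) / (β(1−α)x + (α−β)xy + α(β−1)y), defined when the denominator of P is nonzero. Let x, y, z ∈ K and define: (y₃,z₂) = F_I(β,γ)(y,z), (x₃,z₁₂) = F_I(α,γ)(x,z₂), (x₂₃,y₁₃) = F_I(α,β)(x₃,y₃); and (x₂,y₁) = F_I(α,β)(x,y), (x₂₃',z₁) = F_I(α,γ)(x₂,z), (y₁₃',z₁₂') = F_I(β,γ)(y₁,z₁). Assume the denominator of P is nonzero at each of these six applications. Then x₂₃ = x₂₃', y₁₃ = y₁₃', z₁₂ = z₁₂'; i.e. the map F_I satisfies the parameter-dependent Yang–Baxter relation wherever both composites are defined. -/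
/-- The numerator of `P` in the map `F_I`. -/
def FInum {K : Type*} [Field K] (a b x y : K) : K :=
  (1 - b) * x + b - a + (a - 1) * y

/-- The denominator of `P` in the map `F_I`. -/
def FIden {K : Type*} [Field K] (a b x y : K) : K :=
  b * (1 - a) * x + (a - b) * x * y + a * (b - 1) * y

/-- The map `F_I (α, β) (x, y) = (α·y·P, β·x·P)` with
`P = ((1−β)x + β − α + (α−1)y)/(β(1−α)x + (α−β)xy + α(β−1)y)`, the first representative
in the Adler–Bobenko–Suris classification of quadrirational maps of subclass [2:2]. -/
def FI {K : Type*} [Field K] (a b : K) (p : K × K) : K × K :=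
  (a * p.2 * (FInum a b p.1 p.2 / FIden a b p.1 p.2),
   b * p.1 * (FInum a b p.1 p.2 / FIden a b p.1 p.2))

section

variable {K : Type*} [Field K]

/-- The numerator of the factor by which a Yang–Baxter composite of `F_I` scales `x` to give its
third coordinate. -/
def FItripleNum (α β γ x y z : K) : K :=
  x * FIden β γ y z + (α - 1) * γ * y ^ 2 + (γ - α * β) * y * z + (β - α) * γ * y
    + β * (α - γ) * z

/-- The denominator of the factor by which a Yang–Baxter composite of `F_I` scales `x` to give its
third coordinate. -/
def FItripleDen (α β γ x y z : K) : K :=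
  x * ((α - γ) * y ^ 2 + (β - α) * y * z + (γ - α * β) * y + β * (α - 1) * z)
    - α * y * FInum β γ y z

lemma FIden_swap (a b x y : K) : FIden b a y x = -FIden a b x y := by
  simp only [FIden]; ring

/-- `F_I` commutes with simultaneously exchanging the variables and the parameters. -/
lemma FI_swap (a b x y : K) : FI b a (y, x) = (FI a b (x, y)).swap := by
  have hn : FInum b a y x = -FInum a b x y := by simp only [FInum]; ring
  simp only [FI, hn, FIden_swap a b x y, neg_div_neg_eq, Prod.swap_prod_mk]

lemma FInum_mul_FIden_eq (α β γ x y z : K) :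
    ((1 - γ) * x + γ - α) * FIden β γ y z + (α - 1) * γ * y * FInum β γ y z
      = (1 - γ) * FItripleNum α β γ x y z := by
  simp only [FItripleNum, FInum, FIden]; ring

lemma FIden_mul_FIden_eq (α β γ x y z : K) :
    γ * (1 - α) * x * FIden β γ y z
        + ((α - γ) * x + α * (γ - 1)) * γ * y * FInum β γ y z
      = γ * (1 - γ) * FItripleDen α β γ x y z := by
  simp only [FItripleDen, FInum, FIden]; ring

lemma FInum_triple_eq (α β γ x y z : K) :
    (1 - β) * α * y * FInum β γ y z * FItripleNum α β γ x y z
        + (β - α) * FIden β γ y z * FItripleDen α β γ x y z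
        + (α - 1) * β * z * FInum β γ y z * FItripleDen α β γ x y z
      = (1 - α) * (1 - β) * (y - z) * (γ * y - β * z) * FItripleNum γ β α z y x := by
  simp only [FItripleNum, FItripleDen, FInum, FIden]; ring

lemma FIden_triple_eq (α β γ x y z : K) :
    (1 - α) * y * FItripleNum α β γ x y z * FIden β γ y z
        + (α - β) * y * z * FInum β γ y z * FItripleNum α β γ x y z
        + (β - 1) * z * FItripleDen α β γ x y z * FIden β γ y z
      = (1 - α) * (1 - β) * (y - z) * (γ * y - β * z) * FItripleDen γ β α z y x := by
  simp only [FItripleNum, FItripleDen, FInum, FIden]; ring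

/-- Closed form of the composite of `F_I` on the coordinates `(2, 3)`, then `(1, 3)`, then
`(1, 2)`. -/
lemma FI_triple_eq {α β γ x y z y₃ z₂ x₃ z₁₂ x₂₃ y₁₃ : K}
    (h1 : (y₃, z₂) = FI β γ (y, z))
    (h2 : (x₃, z₁₂) = FI α γ (x, z₂))
    (h3 : (x₂₃, y₁₃) = FI α β (x₃, y₃))
    (d1 : FIden β γ y z ≠ 0) (d2 : FIden α γ x z₂ ≠ 0) (d3 : FIden α β x₃ y₃ ≠ 0) :
    x₂₃ = z * (FItripleNum γ β α z y x / FItripleDen γ β α z y x) ∧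
    y₁₃ = y * ((FItripleNum α β γ x y z / FItripleDen α β γ x y z) *
      (FItripleNum γ β α z y x / FItripleDen γ β α z y x)) ∧
    z₁₂ = x * (FItripleNum α β γ x y z / FItripleDen α β γ x y z) := by
  simp only [FI, Prod.mk.injEq] at h1 h2 h3
  obtain ⟨hy₃, hz₂⟩ := h1
  obtain ⟨hx₃, rfl⟩ := h2
  obtain ⟨rfl, rfl⟩ := h3
  have eA := FInum_mul_FIden_eq α β γ x y z
  have eB := FIden_mul_FIden_eq α β γ x y z
  have eC := FInum_triple_eq α β γ x y z
  have eD := FIden_triple_eq α β γ x y z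
  generalize FItripleNum α β γ x y z = a at *
  generalize FItripleDen α β γ x y z = b at *
  generalize FItripleNum γ β α z y x = c at *
  generalize FItripleDen γ β α z y x = d at *
  generalize FInum β γ y z = N at *
  generalize FIden β γ y z = D at *
  generalize (1 - α) * (1 - β) * (y - z) * (γ * y - β * z) = k at *
  have n2 : FInum α γ x z₂ = (1 - γ) * a / D := by
    rw [← eA, hz₂, FInum]; field_simp
  have e2 : FIden α γ x z₂ = γ * (1 - γ) * b / D := by
    rw [← eB, hz₂, FIden]; field_simp; ring
  rw [e2] at d2
  have hγ : γ ≠ 0 := by rintro rfl; simp at d2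
  have hγ' : 1 - γ ≠ 0 := by intro h; simp [h] at d2
  have hb : b ≠ 0 := by rintro rfl; simp at d2
  have r2 : FInum α γ x z₂ / FIden α γ x z₂ = a / (γ * b) := by
    rw [n2, e2]; field_simp
  rw [r2] at hx₃ ⊢
  have hx : x₃ = α * y * N * a / (D * b) := by rw [hx₃, hz₂]; field_simp
  have n3 : FInum α β x₃ y₃ = k * c / (D * b) := by
    rw [← eC, hx, hy₃, FInum]; field_simp; ring
  have e3 : FIden α β x₃ y₃ = α * β * N * (k * d) / (D ^ 2 * b) := by
    rw [← eD, hx, hy₃, FIden]; field_simp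
  rw [e3] at d3
  have hα : α ≠ 0 := by rintro rfl; simp at d3
  have hβ : β ≠ 0 := by rintro rfl; simp at d3
  have hN : N ≠ 0 := by rintro rfl; simp at d3
  have hk0 : k ≠ 0 := by intro h; simp [h] at d3
  have hd : d ≠ 0 := by rintro rfl; simp at d3
  have r3 : FInum α β x₃ y₃ / FIden α β x₃ y₃ = c * D / (α * β * N * d) := by
    rw [n3, e3]; field_simp
  rw [r3, hx, hy₃]
  refine ⟨?_, ?_, ?_⟩ <;> field_simp

end

/-- The map `F_I` satisfies the parameter-dependent Yang–Baxter relation wherever both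
composite chains are defined. -/
theorem FI_yang_baxter {K : Type*} [Field K] (α β γ x y z : K)
    (y₃ z₂ x₃ z₁₂ x₂₃ y₁₃ x₂ y₁ x₂₃' z₁ y₁₃' z₁₂' : K)
    (h1 : (y₃, z₂) = FI β γ (y, z))
    (h2 : (x₃, z₁₂) = FI α γ (x, z₂))
    (h3 : (x₂₃, y₁₃) = FI α β (x₃, y₃))
    (h4 : (x₂, y₁) = FI α β (x, y))
    (h5 : (x₂₃', z₁) = FI α γ (x₂, z))
    (h6 : (y₁₃', z₁₂') = FI β γ (y₁, z₁))
    (d1 : FIden β γ y z ≠ 0) (d2 : FIden α γ x z₂ ≠ 0) (d3 : FIden α β x₃ y₃ ≠ 0)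
    (d4 : FIden α β x y ≠ 0) (d5 : FIden α γ x₂ z ≠ 0) (d6 : FIden β γ y₁ z₁ ≠ 0) :
    x₂₃ = x₂₃' ∧ y₁₃ = y₁₃' ∧ z₁₂ = z₁₂' := by
  have h4' : (y₁, x₂) = FI β α (y, x) := by rw [FI_swap, ← h4]; rfl
  have h5' : (z₁, x₂₃') = FI γ α (z, x₂) := by rw [FI_swap, ← h5]; rfl
  have h6' : (z₁₂', y₁₃') = FI γ β (z₁, y₁) := by rw [FI_swap, ← h6]; rfl
  obtain ⟨hx, hy, hz⟩ := FI_triple_eq h1 h2 h3 d1 d2 d3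
  obtain ⟨hz', hy', hx'⟩ := FI_triple_eq h4' h5' h6'
    (by rwa [FIden_swap, neg_ne_zero]) (by rwa [FIden_swap, neg_ne_zero])
    (by rwa [FIden_swap, neg_ne_zero])
  exact ⟨hx.trans hx'.symm, by rw [hy, hy', mul_comm (_ / _)], hz.trans hz'.symm⟩
end

section
/- Let K be a field and α, β, γ ∈ K all nonzero. For nonzero parameters α, β define the map F_III(α,β)(x,y) = ((y/α)·P, (x/β)·P) with P = (αx − βy)/(x − y), defined when x ≠ y. Let x, y, z ∈ K and define: (y₃,z₂) = F_III(β,γ)(y,z), (x₃,z₁₂) = F_III(α,γ)(x,z₂), (x₂₃,y₁₃) = F_III(α,β)(x₃,y₃); and (x₂,y₁) = F_III(α,β)(x,y), (x₂₃',z₁) = F_III(α,γ)(x₂,z), (y₁₃',z₁₂') = F_III(β,γ)(y₁,z₁). Assume the two entries are distinct at each of these six applications (so each denominator x − y is nonzero). Then x₂₃ = x₂₃', y₁₃ = y₁₃', z₁₂ = z₁₂'; i.e. F_III satisfies the parameter-dependent Yang–Baxter relation wherever both composites are defined. -/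
/-- The map `F_III (α, β) (x, y) = ((y/α)·P, (x/β)·P)` with `P = (αx − βy)/(x − y)`,
the third representative in the Adler–Bobenko–Suris classification of quadrirational
maps of subclass [2:2]. -/
def FIII {K : Type*} [Field K] (a b : K) (p : K × K) : K × K :=
  ((p.2 / a) * ((a * p.1 - b * p.2) / (p.1 - p.2)),
   (p.1 / b) * ((a * p.1 - b * p.2) / (p.1 - p.2)))

/-- The map `F_III` satisfies the parameter-dependent Yang–Baxter relation wherever both
composite chains are defined. -/
theorem FIII_yang_baxter {K : Type*} [Field K] (α β γ x y z : K)
    (hα : α ≠ 0) (hβ : β ≠ 0) (hγ : γ ≠ 0)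
    (y₃ z₂ x₃ z₁₂ x₂₃ y₁₃ x₂ y₁ x₂₃' z₁ y₁₃' z₁₂' : K)
    (h1 : (y₃, z₂) = FIII β γ (y, z))
    (h2 : (x₃, z₁₂) = FIII α γ (x, z₂))
    (h3 : (x₂₃, y₁₃) = FIII α β (x₃, y₃))
    (h4 : (x₂, y₁) = FIII α β (x, y))
    (h5 : (x₂₃', z₁) = FIII α γ (x₂, z))
    (h6 : (y₁₃', z₁₂') = FIII β γ (y₁, z₁))
    (d1 : y ≠ z) (d2 : x ≠ z₂) (d3 : x₃ ≠ y₃)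
    (d4 : x ≠ y) (d5 : x₂ ≠ z) (d6 : y₁ ≠ z₁) :
    x₂₃ = x₂₃' ∧ y₁₃ = y₁₃' ∧ z₁₂ = z₁₂' := by
  simp only [FIII, Prod.mk.injEq] at h1 h2 h3 h4 h5 h6
  obtain ⟨hy₃, hz₂⟩ := h1
  obtain ⟨hx₃, hz₁₂⟩ := h2
  obtain ⟨hx₂₃, hy₁₃⟩ := h3
  obtain ⟨hx₂, hy₁⟩ := h4
  obtain ⟨hx₂₃', hz₁⟩ := h5
  obtain ⟨hy₁₃', hz₁₂'⟩ := h6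
  have hyz : y - z ≠ 0 := sub_ne_zero.2 d1
  have hxy : x - y ≠ 0 := sub_ne_zero.2 d4
  -- The polynomials N, M, E, G, H, L are, up to the parameters and the differences y - z and
  -- x - y, the nontrivial factors of the intermediate numerators and denominators.
  obtain ⟨N, hN⟩ : ∃ N, N = β * y - γ * z := ⟨_, rfl⟩
  obtain ⟨M, hM⟩ : ∃ M, M = α * x - β * y := ⟨_, rfl⟩
  obtain ⟨E, hE⟩ : ∃ E, E = γ * x * (y - z) - y * N := ⟨_, rfl⟩
  obtain ⟨G, hG⟩ : ∃ G, G = α * x * (y - z) - y * N := ⟨_, rfl⟩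
  obtain ⟨H, hH⟩ : ∃ H, H = y * M - α * z * (x - y) := ⟨_, rfl⟩
  obtain ⟨L, hL⟩ : ∃ L, L = y * M - γ * z * (x - y) := ⟨_, rfl⟩
  have hyGzE : y * G - z * E = (y - z) * L := by subst_vars; ring
  have hNH : β * y * G - α * z * E = N * H := by subst_vars; ring
  have hxHyG : x * H - y * L = (x - y) * G := by subst_vars; ring
  have hME : γ * x * H - β * y * L = M * E := by subst_vars; ring
  rw [← hN] at hy₃ hz₂
  rw [← hM] at hx₂ hy₁
  have e2 : x - z₂ = E / (γ * (y - z)) := by rw [hz₂, hE]; field_simp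
  have hE0 : E ≠ 0 := by
    rintro rfl
    exact d2 (sub_eq_zero.1 (by rw [e2, zero_div]))
  have n2 : α * x - γ * z₂ = G / (y - z) := by rw [hz₂, hG]; field_simp
  have e5 : x₂ - z = H / (α * (x - y)) := by rw [hx₂, hH]; field_simp
  have hH0 : H ≠ 0 := by
    rintro rfl
    exact d5 (sub_eq_zero.1 (by rw [e5, zero_div]))
  have n5 : α * x₂ - γ * z = L / (x - y) := by rw [hx₂, hL]; field_simp
  rw [n2, e2, hz₂] at hx₃
  rw [n2, e2] at hz₁₂
  rw [n5, e5] at hx₂₃'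
  rw [n5, e5, hx₂] at hz₁
  have e3 : x₃ - y₃ = N * (N * H) / (α * β * (y - z) * E) := by
    rw [hx₃, hy₃, ← hNH]; field_simp
  have n3 : α * x₃ - β * y₃ = N * L / E := by
    have : α * x₃ - β * y₃ = N * (y * G - z * E) / ((y - z) * E) := by
      rw [hx₃, hy₃]; field_simp
    rw [this, hyGzE]; field_simp
  have e6 : y₁ - z₁ = M * (M * E) / (β * γ * (x - y) * H) := by
    rw [hy₁, hz₁, ← hME]; field_simp
  have n6 : β * y₁ - γ * z₁ = M * G / H := by
    have : β * y₁ - γ * z₁ = M * (x * H - y * L) / ((x - y) * H) := by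
      rw [hy₁, hz₁]; field_simp
    rw [this, hxHyG]; field_simp
  have hN0 : N ≠ 0 := fun h => d3 (sub_eq_zero.1 (by rw [e3, h, zero_mul, zero_div]))
  have hM0 : M ≠ 0 := fun h => d6 (sub_eq_zero.1 (by rw [e6, h, zero_mul, zero_div]))
  rw [n3, e3] at hx₂₃ hy₁₃
  rw [n6, e6] at hy₁₃' hz₁₂'
  refine ⟨?_, ?_, ?_⟩
  · rw [hx₂₃, hx₂₃', hy₃]; field_simp
  · rw [hy₁₃, hy₁₃', hx₃, hz₁]; field_simp
  · rw [hz₁₂, hz₁₂', hy₁]; field_simp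
end

section
/- Let K be a field and α, β, γ ∈ K. For parameters α, β define the map F_V(α,β)(x,y) = (y + P, x + P) with P = (α − β)/(x − y), defined when x ≠ y. Let x, y, z ∈ K and define: (y₃,z₂) = F_V(β,γ)(y,z), (x₃,z₁₂) = F_V(α,γ)(x,z₂), (x₂₃,y₁₃) = F_V(α,β)(x₃,y₃); and (x₂,y₁) = F_V(α,β)(x,y), (x₂₃',z₁) = F_V(α,γ)(x₂,z), (y₁₃',z₁₂') = F_V(β,γ)(y₁,z₁). Assume the two entries are distinct at each of these six applications (so each denominator x − y is nonzero). Then x₂₃ = x₂₃', y₁₃ = y₁₃', z₁₂ = z₁₂'; i.e. F_V satisfies the parameter-dependent Yang–Baxter relation wherever both composites are defined. -/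
/-- The map `F_V (α, β) (x, y) = (y + P, x + P)` with `P = (α − β)/(x − y)`,
the fifth representative in the Adler–Bobenko–Suris classification of quadrirational
maps of subclass [2:2]. -/
def FV {K : Type*} [Field K] (a b : K) (p : K × K) : K × K :=
  (p.2 + (a - b) / (p.1 - p.2), p.1 + (a - b) / (p.1 - p.2))

/-- If `a` and `b + p` are nonzero and `a ≠ q`, then the increments of the two chains agree:
`q + p a / (b + (p a + q b) / (a - q)) = (p a + q b) / (b + p)`. -/
theorem FV_increment_eq {K : Type*} [Field K] {a b p q : K} (ha : a ≠ 0)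
    (haq : a - q ≠ 0) (hbp : b + p ≠ 0) :
    q + p * a / (b + (p * a + q * b) / (a - q)) = (p * a + q * b) / (b + p) := by
  have h : b + (p * a + q * b) / (a - q) = a * (b + p) / (a - q) := by
    field_simp
    ring
  rw [h]
  field_simp
  ring

/-- The map `F_V` satisfies the parameter-dependent Yang–Baxter relation wherever both
composite chains are defined. -/
theorem FV_yang_baxter {K : Type*} [Field K] (α β γ x y z : K)
    (y₃ z₂ x₃ z₁₂ x₂₃ y₁₃ x₂ y₁ x₂₃' z₁ y₁₃' z₁₂' : K)
    (h1 : (y₃, z₂) = FV β γ (y, z))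
    (h2 : (x₃, z₁₂) = FV α γ (x, z₂))
    (h3 : (x₂₃, y₁₃) = FV α β (x₃, y₃))
    (h4 : (x₂, y₁) = FV α β (x, y))
    (h5 : (x₂₃', z₁) = FV α γ (x₂, z))
    (h6 : (y₁₃', z₁₂') = FV β γ (y₁, z₁))
    (d1 : x ≠ y) (d2 : y ≠ z) (d3 : x₃ ≠ y₃)
    (d4 : x ≠ z₂) (d5 : x₂ ≠ z) (d6 : y₁ ≠ z₁) :
    x₂₃ = x₂₃' ∧ y₁₃ = y₁₃' ∧ z₁₂ = z₁₂' := by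
  simp only [FV, Prod.mk.injEq] at h1 h2 h3 h4 h5 h6
  obtain ⟨rfl, rfl⟩ := h1
  obtain ⟨rfl, rfl⟩ := h2
  obtain ⟨rfl, rfl⟩ := h3
  obtain ⟨rfl, rfl⟩ := h4
  obtain ⟨rfl, rfl⟩ := h5
  obtain ⟨rfl, rfl⟩ := h6
  clear d3 d6
  have ha : x - y ≠ 0 := sub_ne_zero.mpr d1
  have hb : y - z ≠ 0 := sub_ne_zero.mpr d2
  obtain ⟨p, hp⟩ : ∃ p, (α - β) / (x - y) = p := ⟨_, rfl⟩
  obtain ⟨q, hq⟩ : ∃ q, (β - γ) / (y - z) = q := ⟨_, rfl⟩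
  have hαβ : α - β = p * (x - y) := (div_eq_iff ha).mp hp
  have hβγ : β - γ = q * (y - z) := (div_eq_iff hb).mp hq
  have hαγ : α - γ = p * (x - y) + q * (y - z) := by rw [← hαβ, ← hβγ]; ring
  rw [hq] at d4
  rw [hp] at d5
  rw [hp, hq, hαγ, hαβ, hβγ]
  have haq : x - y - q ≠ 0 := fun h => d4 (by linear_combination h)
  have hbp : y - z + p ≠ 0 := fun h => d5 (by linear_combination h)
  have hQ := FV_increment_eq ha haq hbp
  -- The other increment identity is the same one under `(a, b, p, q) ↦ (b, a, -q, -p)`.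
  have hP : p + q * (y - z) / (x - y - (p * (x - y) + q * (y - z)) / (y - z + p)) =
      (p * (x - y) + q * (y - z)) / (x - y - q) := by
    have h := FV_increment_eq (a := y - z) (b := x - y) (p := -q) (q := -p) hb
      (by rwa [sub_neg_eq_add]) (by rwa [← sub_eq_add_neg])
    rw [show -q * (y - z) + -p * (x - y) = -(p * (x - y) + q * (y - z)) by ring,
      sub_neg_eq_add, ← sub_eq_add_neg, neg_mul, neg_div, neg_div, neg_div,
      ← sub_eq_add_neg] at h
    linear_combination -h
  rw [show x - (y + q) = x - y - q by ring, show y + p - z = y - z + p by ring]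
  generalize (p * (x - y) + q * (y - z)) / (x - y - q) = P at *
  generalize (p * (x - y) + q * (y - z)) / (y - z + p) = Q at *
  rw [show y + q + P - (z + q) = y - z + P by ring,
    show x + p - (y + p + Q) = x - y - Q by ring]
  refine ⟨?_, ?_, ?_⟩
  · linear_combination hQ
  · linear_combination hQ - hP
  · linear_combination -hP
end
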